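/- Let Φ be a TH system with split sequence {φ_i}_{i=1}^d. Then the split sequence of the dual TH system Φ* = (A*; {E*_i}; A; {E_i}) is {φ_{d-i+1}}_{i=1}^d. -/

import Mathlib

/-- A thin Hessenberg system on `V`: multiplicity-free `A`, `Astar` with
orderings of primitive idempotents `E`, `Estar` (eigenvalues `θ`, `θs`)
satisfying the Hessenberg conditions. -/
structure THSystem (K V : Type*) [Field K] [AddCommGroup V] [Module K V] (d : ℕ) where
  A : Module.End K V
  Astar : Module.End K V
  E : Fin (d + 1) → Module.End K V
  Estar : Fin (d + 1) → Module.End K V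
  θ : Fin (d + 1) → K
  θs : Fin (d + 1) → K
  finrank_eq : Module.finrank K V = d + 1
  θ_inj : Function.Injective θ
  θs_inj : Function.Injective θs
  sum_E : ∑ i, E i = 1
  E_mul : ∀ i j, E i * E j = if i = j then E i else 0
  E_ne : ∀ i, E i ≠ 0
  sum_Es : ∑ i, Estar i = 1
  Es_mul : ∀ i j, Estar i * Estar j = if i = j then Estar i else 0
  Es_ne : ∀ i, Estar i ≠ 0
  A_eq : A = ∑ i, θ i • E i
  As_eq : Astar = ∑ i, θs i • Estar i
  EAsE_zero : ∀ i j : Fin (d + 1), (j : ℕ) + 1 < (i : ℕ) → E i * Astar * E j = 0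
  EAsE_ne : ∀ i j : Fin (d + 1), (i : ℕ) = (j : ℕ) + 1 → E i * Astar * E j ≠ 0
  EsAEs_zero : ∀ i j : Fin (d + 1), (j : ℕ) + 1 < (i : ℕ) → Estar i * A * Estar j = 0
  EsAEs_ne : ∀ i j : Fin (d + 1), (i : ℕ) = (j : ℕ) + 1 → Estar i * A * Estar j ≠ 0
/-- The split decomposition subspaces
`U_i = (Σ_{h ≤ i} E*_h V) ⊓ (Σ_{h ≤ d-i} E_h V)`. -/
def splitU {K V : Type*} [Field K] [AddCommGroup V] [Module K V] {d : ℕ}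
    (Φ : THSystem K V d) (i : Fin (d + 1)) : Submodule K V :=
  (⨆ h : Fin (d + 1), ⨆ _ : (h : ℕ) ≤ (i : ℕ), LinearMap.range (Φ.Estar h)) ⊓
  (⨆ h : Fin (d + 1), ⨆ _ : (h : ℕ) ≤ d - (i : ℕ), LinearMap.range (Φ.E h))
/-- `φ` is the split sequence of `Φ`:
`(A - θ_{d-i+1}) (A* - θ*_i)` acts on `U_i` as `φ_i`, for `1 ≤ i ≤ d`. -/
def IsSplitSeq {K V : Type*} [Field K] [AddCommGroup V] [Module K V] {d : ℕ}
    (Φ : THSystem K V d) (φ : Fin (d + 1) → K) : Prop :=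
  ∀ i : Fin (d + 1), ∀ hi : 1 ≤ (i : ℕ), ∀ u ∈ splitU Φ i,
    (Φ.A - Φ.θ ⟨d - (i : ℕ) + 1, by have := i.isLt; omega⟩ • (1 : Module.End K V))
      ((Φ.Astar - Φ.θs i • (1 : Module.End K V)) u) = φ i • u
/-- The dual TH system `Φ* = (A*; {E*_i}; A; {E_i})`. -/
def THSystem.dual {K V : Type*} [Field K] [AddCommGroup V] [Module K V] {d : ℕ}
    (Φ : THSystem K V d) : THSystem K V d where
  A := Φ.Astar
  Astar := Φ.A
  E := Φ.Estar
  Estar := Φ.E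
  θ := Φ.θs
  θs := Φ.θ
  finrank_eq := Φ.finrank_eq
  θ_inj := Φ.θs_inj
  θs_inj := Φ.θ_inj
  sum_E := Φ.sum_Es
  E_mul := Φ.Es_mul
  E_ne := Φ.Es_ne
  sum_Es := Φ.sum_E
  Es_mul := Φ.E_mul
  Es_ne := Φ.E_ne
  A_eq := Φ.As_eq
  As_eq := Φ.A_eq
  EAsE_zero := Φ.EsAEs_zero
  EAsE_ne := Φ.EsAEs_ne
  EsAEs_zero := Φ.EAsE_zero
  EsAEs_ne := Φ.EAsE_ne

/-- Membership in an initial sum of ranges of a system of orthogonal idempotents. -/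
theorem mem_iSup_range_iff {K V : Type*} [Field K] [AddCommGroup V] [Module K V] {d : ℕ}
    {E : Fin (d + 1) → Module.End K V} (hsum : ∑ i, E i = 1)
    (hmul : ∀ i j, E i * E j = if i = j then E i else 0) (n : ℕ) (x : V) :
    x ∈ (⨆ h : Fin (d + 1), ⨆ _ : (h : ℕ) ≤ n, LinearMap.range (E h)) ↔
      ∀ h : Fin (d + 1), n < (h : ℕ) → E h x = 0 := by
  constructor
  · intro hx h hh
    have hle : (⨆ h : Fin (d + 1), ⨆ _ : (h : ℕ) ≤ n, LinearMap.range (E h)) ≤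
        LinearMap.ker (E h) := by
      refine iSup₂_le fun k hk => ?_
      rintro _ ⟨y, rfl⟩
      have hkh : h ≠ k := by rintro rfl; omega
      have := LinearMap.congr_fun (hmul h k) y
      simpa [hkh] using this
    exact hle hx
  · intro hx
    have hxs : x = ∑ k, E k x := by
      rw [← LinearMap.sum_apply, hsum, Module.End.one_apply]
    rw [hxs]
    refine Submodule.sum_mem _ fun k _ => ?_
    by_cases hk : (k : ℕ) ≤ n
    · exact Submodule.mem_iSup_of_mem k (Submodule.mem_iSup_of_mem hk ⟨x, rfl⟩)
    · rw [hx k (by omega)]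
      exact Submodule.zero_mem _

/-- A system of `dim V` nonzero orthogonal idempotents consists of rank one maps. -/
theorem exists_forall_idempotent_apply_eq_smul {K V : Type*} [Field K] [AddCommGroup V]
    [Module K V] {d : ℕ} (hV : Module.finrank K V = d + 1)
    {E : Fin (d + 1) → Module.End K V}
    (hmul : ∀ i j, E i * E j = if i = j then E i else 0) (hne : ∀ i, E i ≠ 0)
    (h : Fin (d + 1)) : ∃ v : V, ∀ x, ∃ c : K, E h x = c • v := by
  have hex : ∀ i, ∃ y, E i y ≠ 0 := fun i => by
    by_contra! hc
    exact hne i (LinearMap.ext hc)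
  choose y hy using hex
  have hE : ∀ i j, E i (E j (y j)) = if i = j then E j (y j) else 0 := fun i j => by
    have := LinearMap.congr_fun (hmul i j) (y j)
    rw [Module.End.mul_apply] at this
    rw [this]
    split_ifs with hij
    · rw [hij]
    · rfl
  have hli : LinearIndependent K fun i => E i (y i) := by
    rw [Fintype.linearIndependent_iff]
    intro g hg i
    have := congrArg (E i) hg
    simpa [map_sum, hE, hy i] using this
  let b := basisOfLinearIndependentOfCardEqFinrank hli (by simp [hV])
  refine ⟨E h (y h), fun x => ⟨b.repr x h, ?_⟩⟩
  conv_lhs => rw [← b.sum_repr x]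
  simp [b, map_sum, hE]

namespace THSystem

variable {K V : Type*} [Field K] [AddCommGroup V] [Module K V] {d : ℕ} (Φ : THSystem K V d)

theorem E_A_apply (h : Fin (d + 1)) (x : V) : Φ.E h (Φ.A x) = Φ.θ h • Φ.E h x := by
  have : Φ.E h * Φ.A = Φ.θ h • Φ.E h := by
    rw [Φ.A_eq]
    simp [Finset.mul_sum, Φ.E_mul]
  exact LinearMap.congr_fun this x

theorem Estar_A_apply_eq_sum (h : Fin (d + 1)) (x : V) :
    Φ.Estar h (Φ.A x) = ∑ k, (Φ.Estar h * Φ.A * Φ.Estar k) (Φ.Estar k x) := by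
  have hidem : ∀ k, Φ.Estar k (Φ.Estar k x) = Φ.Estar k x := fun k => by
    simpa using LinearMap.congr_fun (Φ.Es_mul k k) x
  have hx : x = ∑ k, Φ.Estar k x := by
    rw [← LinearMap.sum_apply, Φ.sum_Es, Module.End.one_apply]
  conv_lhs => rw [hx]
  simp [map_sum, hidem]

theorem Estar_A_apply_eq_zero {n : ℕ} {x : V}
    (hx : ∀ h : Fin (d + 1), n < (h : ℕ) → Φ.Estar h x = 0) (h : Fin (d + 1))
    (hh : n + 1 < (h : ℕ)) : Φ.Estar h (Φ.A x) = 0 := by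
  rw [Φ.Estar_A_apply_eq_sum]
  refine Finset.sum_eq_zero fun k _ => ?_
  by_cases hk : (k : ℕ) ≤ n
  · rw [Φ.EsAEs_zero h k (by omega), LinearMap.zero_apply]
  · rw [hx k (by omega), map_zero]

theorem Estar_apply_eq_zero_of_succ {h k : Fin (d + 1)} (hhk : (h : ℕ) = (k : ℕ) + 1) {x : V}
    (hx : (Φ.Estar h * Φ.A * Φ.Estar k) x = 0) : Φ.Estar k x = 0 := by
  obtain ⟨v, hv⟩ := exists_forall_idempotent_apply_eq_smul Φ.finrank_eq Φ.Es_mul Φ.Es_ne k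
  obtain ⟨c, hc⟩ := hv x
  by_contra hne
  have hc0 : c ≠ 0 := by
    rintro rfl
    exact hne (by rw [hc, zero_smul])
  have hv0 : Φ.Estar h (Φ.A v) = 0 := by
    simpa [hc, hc0] using hx
  refine Φ.EsAEs_ne h k hhk (LinearMap.ext fun z => ?_)
  obtain ⟨e, he⟩ := hv z
  simp [he, hv0]

/-- No eigenvector of `A` is annihilated by the last dual idempotent. -/
theorem eq_zero_of_A_apply_eq_smul {x : V} {t : K} (hA : Φ.A x = t • x)
    (hlast : Φ.Estar (Fin.last d) x = 0) : x = 0 := by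
  have key : ∀ n : ℕ, ∀ h : Fin (d + 1), d ≤ (h : ℕ) + n → Φ.Estar h x = 0 := by
    intro n
    induction n with
    | zero =>
      intro h hh
      have : h = Fin.last d := Fin.ext (by have := h.isLt; simp; omega)
      rw [this, hlast]
    | succ n ih =>
      intro k hk
      by_cases hkn : d ≤ (k : ℕ) + n
      · exact ih k hkn
      by_cases hkd : (k : ℕ) = d
      · omega
      have hlt : (k : ℕ) + 1 < d + 1 := by have := k.isLt; omega
      have hsum := Φ.Estar_A_apply_eq_sum ⟨k + 1, hlt⟩ x
      rw [hA, map_smul, ih ⟨k + 1, hlt⟩ (by simp only; omega), smul_zero,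
        Finset.sum_eq_single k] at hsum
      · have := Φ.Estar_apply_eq_zero_of_succ (h := ⟨k + 1, hlt⟩) rfl hsum.symm
        have hidem := LinearMap.congr_fun (Φ.Es_mul k k) x
        rw [Module.End.mul_apply, this] at hidem
        simpa using hidem.symm
      · intro l _ hl
        rcases lt_or_gt_of_ne (Fin.val_ne_of_ne hl) with h | h
        · rw [Φ.EsAEs_zero _ l (by simp only; omega), LinearMap.zero_apply]
        · rw [ih l (by omega), map_zero]
      · simp
  have hx : x = ∑ k, Φ.Estar k x := by
    rw [← LinearMap.sum_apply, Φ.sum_Es, Module.End.one_apply]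
  rw [hx]
  exact Finset.sum_eq_zero fun k _ => key d k (by omega)

theorem mem_splitU_iff (i : Fin (d + 1)) (x : V) :
    x ∈ splitU Φ i ↔ (∀ h : Fin (d + 1), (i : ℕ) < h → Φ.Estar h x = 0) ∧
      ∀ h : Fin (d + 1), d - (i : ℕ) < h → Φ.E h x = 0 := by
  rw [splitU, Submodule.mem_inf, mem_iSup_range_iff Φ.sum_Es Φ.Es_mul,
    mem_iSup_range_iff Φ.sum_E Φ.E_mul]

theorem mem_splitU_dual_iff {i j : Fin (d + 1)} (hij : (i : ℕ) + j = d) (x : V) :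
    x ∈ splitU Φ.dual i ↔ x ∈ splitU Φ j := by
  rw [mem_splitU_iff, mem_splitU_iff, and_comm, show d - (i : ℕ) = j by omega,
    show d - (j : ℕ) = i by omega]
  rfl

theorem A_sub_smul_apply_mem_splitU {i j k : Fin (d + 1)} (hj : (j : ℕ) = (i : ℕ) + 1)
    (hk : (k : ℕ) = d - (i : ℕ)) {x : V} (hx : x ∈ splitU Φ i) :
    (Φ.A - Φ.θ k • (1 : Module.End K V)) x ∈ splitU Φ j := by
  rw [mem_splitU_iff] at hx ⊢
  obtain ⟨h1, h2⟩ := hx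
  simp only [LinearMap.sub_apply, LinearMap.smul_apply, Module.End.one_apply, map_sub, map_smul]
  refine ⟨fun h hh => ?_, fun h hh => ?_⟩
  · rw [Φ.Estar_A_apply_eq_zero h1 h (by omega), h1 h (by omega), smul_zero, sub_zero]
  · rw [E_A_apply]
    by_cases hhk : h = k
    · rw [hhk, sub_self]
    · have := Fin.val_ne_of_ne hhk
      rw [h2 h (by omega), smul_zero, smul_zero, sub_zero]

end THSystem

/-- The split sequence of the dual system `Φ*` is `{φ_{d-i+1}}_{i=1}^d`. -/
theorem dual_splitSeq {K V : Type*} [Field K] [AddCommGroup V] [Module K V]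
    {d : ℕ} (Φ : THSystem K V d) (φ : Fin (d + 1) → K) (hφ : IsSplitSeq Φ φ) :
    ∀ i : Fin (d + 1), ∀ hi : 1 ≤ (i : ℕ), ∀ u ∈ splitU Φ.dual i,
      (Φ.dual.A - Φ.dual.θ ⟨d - (i : ℕ) + 1, by have := i.isLt; omega⟩ • (1 : Module.End K V))
        ((Φ.dual.Astar - Φ.dual.θs i • (1 : Module.End K V)) u)
      = φ ⟨d - (i : ℕ) + 1, by have := i.isLt; omega⟩ • u := by
  intro i hi u hu
  have hid := i.isLt
  let p : Fin (d + 1) := ⟨d - i, by omega⟩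
  let j : Fin (d + 1) := ⟨d - i + 1, by omega⟩
  have hup : u ∈ splitU Φ p :=
    (Φ.mem_splitU_dual_iff (i := i) (j := p) (by simp only [p]; omega) u).1 hu
  set B := Φ.A - Φ.θ i • (1 : Module.End K V) with hB
  set C := Φ.Astar - Φ.θs j • (1 : Module.End K V)
  change C (B u) = φ j • u
  have hBu : B u ∈ splitU Φ j :=
    Φ.A_sub_smul_apply_mem_splitU (i := p) rfl (by simp only [p]; omega) hup
  let q : Fin (d + 1) := ⟨i - 1, by omega⟩
  have hCBu : C (B u) ∈ splitU Φ p := by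
    rw [← Φ.mem_splitU_dual_iff (i := i) (j := p) (by simp only [p]; omega)]
    refine Φ.dual.A_sub_smul_apply_mem_splitU (i := q) (j := i) (k := j)
      (by simp only [q]; omega) (by simp only [q, j]; omega) ?_
    exact (Φ.mem_splitU_dual_iff (by simp only [q, j]; omega) _).2 hBu
  have hsplit : B (C (B u)) = φ j • B u := by
    have := hφ j (by simp [j]) (B u) hBu
    have hidx : (⟨d - (j : ℕ) + 1, by have : (j : ℕ) = d - i + 1 := rfl; omega⟩ : Fin (d + 1)) = i :=
      Fin.ext (show d - (d - (i : ℕ) + 1) + 1 = i by omega)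
    rwa [hidx] at this
  have hmem : C (B u) - φ j • u ∈ splitU Φ p :=
    Submodule.sub_mem _ hCBu (Submodule.smul_mem _ _ hup)
  have hker : B (C (B u) - φ j • u) = 0 := by
    rw [map_sub, map_smul, hsplit, sub_self]
  refine sub_eq_zero.1 (Φ.eq_zero_of_A_apply_eq_smul (t := Φ.θ i) ?_ ?_)
  · rw [hB] at hker ⊢
    exact sub_eq_zero.1 hker
  · exact ((Φ.mem_splitU_iff p _).1 hmem).1 _ (by simp only [p, Fin.val_last]; omega)
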